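/- arXiv:2406.16656 — 2 statements merged into one kernel-verified Lean document; each statement's English description precedes it below -/
import Mathlib

section
/- For all integers n > t ≥ 1 and every permutation σ ∈ S_n, the number of permutations π ∈ S_n with π ≠ σ and d_U(σ,π) ≤ t is at most binom(n,t) · t! · binom(n,t). -/
open scoped Classical

/-- A translocation: move the symbol at (0-indexed) position `i` to position `j`,
shifting intermediate symbols by one position. -/
def translocate {α : Type*} (l : List α) (i j : ℕ) : List α :=
  match l[i]? with
  | some a => (l.eraseIdx i).insertIdx j a
  | none => l

/-- The Ulam distance between two sequences: the minimum number of translocations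
needed to transform `x` into `y`. -/
noncomputable def ulamDist {α : Type*} (x y : List α) : ℕ :=
  sInf {m | ∃ g : ℕ → List α, g 0 = x ∧ g m = y ∧
    ∀ k < m, ∃ i j, i < (g k).length ∧ j < (g k).length ∧ i ≠ j ∧
      g (k+1) = translocate (g k) i j}

/-- The sequence form of a permutation of `{1,...,n}` (values written `1`-indexed). -/
def seqOf {n : ℕ} (π : Equiv.Perm (Fin n)) : List ℕ :=
  List.ofFn fun i => (π i : ℕ) + 1

/-- The Ulam distance between two permutations. -/
noncomputable def dU {n : ℕ} (π σ : Equiv.Perm (Fin n)) : ℕ :=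
  ulamDist (seqOf π) (seqOf σ)

/-- Length of a longest common subsequence of two sequences. -/
noncomputable def lcsLen {α : Type*} (x y : List α) : ℕ :=
  sSup {k | ∃ z : List α, z.Sublist x ∧ z.Sublist y ∧ z.length = k}

/-- Levenshtein distance: minimum number of insertions and deletions needed to
transform `x` into `y`. -/
noncomputable def levDist {α : Type*} (x y : List α) : ℕ :=
  sInf {m | ∃ g : ℕ → List α, g 0 = x ∧ g m = y ∧
    ∀ k < m, (∃ i a, i ≤ (g k).length ∧ g (k+1) = (g k).insertIdx i a) ∨
      (∃ i, i < (g k).length ∧ g (k+1) = (g k).eraseIdx i)}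

/-- Hamming distance between two permutations: number of positions where they differ. -/
def dH {m : ℕ} (a b : Equiv.Perm (Fin m)) : ℕ :=
  (Finset.univ.filter fun i => a i ≠ b i).card

/-- `bar π` = the permutation `π` of `{1,...,n}` extended to `{1,...,n+1}` by
appending the symbol `n+1` at the end (i.e. fixing the last point). -/
def bar {n : ℕ} (π : Equiv.Perm (Fin n)) : Equiv.Perm (Fin (n+1)) :=
  (Equiv.permCongr finSuccEquivLast).symm π.optionCongr

/-- The map `f : S_n → S_{n+1}`: `fmap π` sends each symbol `i` to the symbol
that cyclically follows `i` in the sequence form of `bar π`, i.e.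
`f(π̄)_i = π̄_{π̄⁻¹(i)+1}` for `i ≤ n` and `f(π̄)_{n+1} = π̄_1`. -/
def fmap {n : ℕ} (π : Equiv.Perm (Fin n)) : Equiv.Perm (Fin (n+1)) :=
  bar π * finRotate (n+1) * (bar π)⁻¹

/-- The deletion ball `D_t(π)`: all sequences of length `n - t` obtained from `π`
by deleting `t` symbols, i.e. all subsequences of `π` of length `n - t`. -/
def Dball {n : ℕ} (t : ℕ) (π : Equiv.Perm (Fin n)) : Set (List ℕ) :=
  {s | s.Sublist (seqOf π) ∧ s.length = n - t}

/-- `Mnt n t`: the maximum size of a subset of `S_n` whose distinct elements have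
pairwise Ulam distance greater than `t`. -/
noncomputable def Mnt (n t : ℕ) : ℕ :=
  sSup {m | ∃ C : Finset (Equiv.Perm (Fin n)),
    (∀ π ∈ C, ∀ σ ∈ C, π ≠ σ → t < dU π σ) ∧ C.card = m}

/-- `y` arises from `x` by one translocation between two distinct positions. -/
def TranslocStep {α : Type*} (x y : List α) : Prop :=
  ∃ i j, i < x.length ∧ j < x.length ∧ i ≠ j ∧ y = translocate x i j

lemma translocate_cons {α : Type*} (a : α) (l : List α) (i j : ℕ) :
    translocate (a :: l) (i + 1) (j + 1) = a :: translocate l i j := by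
  unfold translocate
  rw [List.getElem?_cons_succ]
  cases l[i]? <;> simp

lemma TranslocStep.cons {α : Type*} {x y : List α} (a : α) (h : TranslocStep x y) :
    TranslocStep (a :: x) (a :: y) := by
  obtain ⟨i, j, hi, hj, hij, rfl⟩ := h
  exact ⟨i + 1, j + 1, by simpa using hi, by simpa using hj, by simpa using hij,
    (translocate_cons a x i j).symm⟩

lemma List.Perm.reflTransGen_translocStep {α : Type*} {x y : List α} (h : x.Perm y) :
    Relation.ReflTransGen TranslocStep x y := by
  induction h with
  | nil => exact .refl
  | cons a _ ih => exact Relation.ReflTransGen.lift (a :: ·) (fun _ _ => TranslocStep.cons a) _ _ ih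
  | swap a b l => exact .single ⟨0, 1, by simp, by simp, by simp, by simp [translocate]⟩
  | trans _ _ ih₁ ih₂ => exact ih₁.trans ih₂

lemma exists_chain_of_reflTransGen {α : Type*} {r : α → α → Prop} {x y : α}
    (h : Relation.ReflTransGen r x y) :
    ∃ (m : ℕ) (g : ℕ → α), g 0 = x ∧ g m = y ∧ ∀ k < m, r (g k) (g (k + 1)) := by
  induction h with
  | refl => exact ⟨0, fun _ => x, rfl, rfl, by simp⟩
  | @tail b c _ hbc ih =>
    obtain ⟨m, g, h0, hm, hg⟩ := ih
    refine ⟨m + 1, fun k => if k ≤ m then g k else c, by simpa using h0, by simp, fun k hk => ?_⟩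
    rcases Nat.lt_succ_iff_lt_or_eq.mp hk with hk | rfl
    · simpa [hk.le, Nat.succ_le_of_lt hk] using hg k hk
    · simpa [hm] using hbc

/-- The infimum defining the Ulam distance of two rearrangements of each other is attained. -/
lemma List.Perm.exists_chain_ulamDist {α : Type*} {x y : List α} (h : x.Perm y) :
    ∃ g : ℕ → List α, g 0 = x ∧ g (ulamDist x y) = y ∧
      ∀ k < ulamDist x y, TranslocStep (g k) (g (k + 1)) :=
  Nat.sInf_mem (s := {m | ∃ g : ℕ → List α, g 0 = x ∧ g m = y ∧
    ∀ k < m, TranslocStep (g k) (g (k + 1))})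
    (exists_chain_of_reflTransGen h.reflTransGen_translocStep)

lemma filter_insertIdx_of_neg {α : Type*} (p : α → Bool) {a : α} (ha : p a = false)
    (l : List α) (j : ℕ) : (l.insertIdx j a).filter p = l.filter p := by
  induction l generalizing j with
  | nil => cases j <;> simp [ha]
  | cons b l ih => cases j <;> simp [List.filter_cons, ha, ih]

lemma filter_eraseIdx_of_neg {α : Type*} (p : α → Bool) {a : α} (ha : p a = false)
    {l : List α} {i : ℕ} (hi : l[i]? = some a) : (l.eraseIdx i).filter p = l.filter p := by
  induction l generalizing i with
  | nil => simp
  | cons b l ih =>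
    cases i with
    | zero => simp_all
    | succ i => simp [List.filter_cons, ih (by simpa using hi)]

lemma TranslocStep.exists_filter_eq {α : Type*} {x y : List α} (h : TranslocStep x y) :
    ∃ a, ∀ p : α → Bool, p a = false → y.filter p = x.filter p := by
  obtain ⟨i, j, hi, -, -, rfl⟩ := h
  have hx : x[i]? = some x[i] := List.getElem?_eq_getElem hi
  refine ⟨x[i], fun p hp => ?_⟩
  simp only [translocate, hx]
  rw [filter_insertIdx_of_neg p hp, filter_eraseIdx_of_neg p hp hx]

lemma exists_filter_eq_of_chain {α : Type*} {g : ℕ → List α} {m : ℕ}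
    (hg : ∀ k < m, TranslocStep (g k) (g (k + 1))) :
    ∃ s : Finset α, s.card ≤ m ∧
      ∀ p : α → Bool, (∀ a ∈ s, p a = false) → (g m).filter p = (g 0).filter p := by
  induction m with
  | zero => exact ⟨∅, by simp, by simp⟩
  | succ m ih =>
    obtain ⟨s, hs, h⟩ := ih fun k hk => hg k (hk.trans m.lt_succ_self)
    obtain ⟨a, ha⟩ := (hg m m.lt_succ_self).exists_filter_eq
    refine ⟨insert a s, (Finset.card_insert_le a s).trans (by omega), fun p hp => ?_⟩
    rw [ha p (hp a (Finset.mem_insert_self a s)),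
      h p fun b hb => hp b (Finset.mem_insert_of_mem hb)]

lemma seqOf_eq_map {n : ℕ} (π : Equiv.Perm (Fin n)) :
    seqOf π = ((List.finRange n).map π).map fun i : Fin n => (i : ℕ) + 1 := by
  rw [seqOf, List.ofFn_eq_map, List.map_map]
  rfl

lemma seqOf_perm {n : ℕ} (σ π : Equiv.Perm (Fin n)) : (seqOf σ).Perm (seqOf π) := by
  rw [seqOf_eq_map, seqOf_eq_map]
  exact ((Equiv.Perm.map_finRange_perm σ).trans (Equiv.Perm.map_finRange_perm π).symm).map _

/-- Permutations at Ulam distance at most `t` agree after deleting some `t` symbols. -/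
lemma exists_filter_eq_of_dU_le {n t : ℕ} (htn : t ≤ n) {σ π : Equiv.Perm (Fin n)}
    (h : dU σ π ≤ t) :
    ∃ S : Finset (Fin n), S.card = t ∧
      ((List.finRange n).map π).filter (fun a => decide (a ∉ S)) =
        ((List.finRange n).map σ).filter (fun a => decide (a ∉ S)) := by
  obtain ⟨g, h0, hm, hg⟩ := (seqOf_perm σ π).exists_chain_ulamDist
  obtain ⟨s, hs, hf⟩ := exists_filter_eq_of_chain hg
  have hinj : Function.Injective fun i : Fin n => (i : ℕ) + 1 := fun i j hij =>
    Fin.ext (Nat.succ_injective hij)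
  obtain ⟨S, hsS, hS⟩ := Finset.exists_superset_card_eq
    (s := s.preimage _ hinj.injOn) (n := t)
    (((Finset.card_le_card_of_injOn _ (fun i hi => Finset.mem_preimage.mp hi)
      hinj.injOn).trans hs).trans h) (by simpa using htn)
  refine ⟨S, hS, hinj.list_map ?_⟩
  have hp : ∀ i : Fin n,
      decide ((i : ℕ) + 1 ∉ s ∧ (i : ℕ) + 1 ∉ S.image fun i : Fin n => (i : ℕ) + 1) =
        decide (i ∉ S) := fun i => by
    have h₁ : (i : ℕ) + 1 ∈ s → i ∈ S := fun hi => hsS (Finset.mem_preimage.mpr hi)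
    rw [decide_eq_decide, hinj.mem_finset_image (a := i) (s := S)]
    tauto
  have key := hf (fun b => decide (b ∉ s ∧ b ∉ S.image fun i : Fin n => (i : ℕ) + 1))
    fun a ha => by simp [ha]
  change List.filter _ (g (dU σ π)) = _ at key
  rw [h0, show g (dU σ π) = seqOf π from hm, seqOf_eq_map, seqOf_eq_map,
    List.filter_map, List.filter_map (l := (List.finRange n).map σ)] at key
  simp only [Function.comp_def, hp] at key
  exact key

/-- A permutation is determined by its values at the positions of the symbols in `S`
together with the sequence of the remaining symbols. -/
lemma eq_of_filter_map_eq {n : ℕ} {S P : Finset (Fin n)} {π ρ : Equiv.Perm (Fin n)}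
    (hπ : ∀ i, π i ∈ S ↔ i ∈ P) (hρ : ∀ i, ρ i ∈ S ↔ i ∈ P)
    (hf : ((List.finRange n).map π).filter (fun a => decide (a ∉ S)) =
      ((List.finRange n).map ρ).filter (fun a => decide (a ∉ S)))
    (hP : ∀ i ∈ P, π i = ρ i) : π = ρ := by
  ext1 i
  by_cases hi : i ∈ P
  · exact hP i hi
  · simp only [List.filter_map, Function.comp_def, hπ, hρ] at hf
    exact List.map_inj_left.mp hf i (by simpa using hi)

lemma card_filter_map_eq_le {n t : ℕ} {S P : Finset (Fin n)} (hS : S.card = t)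
    (hP : P.card = t) (L : List (Fin n)) :
    (Finset.univ.filter fun π : Equiv.Perm (Fin n) => (∀ i, π i ∈ S ↔ i ∈ P) ∧
      ((List.finRange n).map π).filter (fun a => decide (a ∉ S)) = L).card ≤ t.factorial := by
  have hcard : Fintype.card (P ↪ S) = t.factorial := by
    simp [Fintype.card_embedding_eq, hS, hP, Nat.descFactorial_self]
  rw [← hcard, ← Fintype.card_coe]
  refine Fintype.card_le_of_injective
    (fun π => ⟨fun i => ⟨π.1 i, ((Finset.mem_filter.mp π.2).2.1 i).mpr i.2⟩,
      fun i j hij => Subtype.ext (π.1.injective (congrArg Subtype.val hij))⟩) ?_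
  rintro ⟨π, hπ⟩ ⟨ρ, hρ⟩ h
  obtain ⟨-, hπ, hπL⟩ := Finset.mem_filter.mp hπ
  obtain ⟨-, hρ, hρL⟩ := Finset.mem_filter.mp hρ
  refine Subtype.ext (eq_of_filter_map_eq hπ hρ (hπL.trans hρL.symm) fun i hi => ?_)
  exact congrArg Subtype.val (DFunLike.congr_fun h ⟨i, hi⟩)

/-- size of the confusable set: for `n > t ≥ 1` and any `σ ∈ S_n`, the
number of `π ≠ σ` with `d_U(σ,π) ≤ t` is at most `C(n,t) · t! · C(n,t)`. -/
theorem stmt3 (n t : ℕ) (ht : 1 ≤ t) (htn : t < n) (σ : Equiv.Perm (Fin n)) :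
    ({π : Equiv.Perm (Fin n) | π ≠ σ ∧ dU σ π ≤ t}).ncard ≤
      n.choose t * t.factorial * n.choose t := by
  let T := (Finset.univ : Finset (Fin n)).powersetCard t
  let F : Finset (Fin n) × Finset (Fin n) → Finset (Equiv.Perm (Fin n)) := fun q =>
    Finset.univ.filter fun π => (∀ i, π i ∈ q.1 ↔ i ∈ q.2) ∧
      ((List.finRange n).map π).filter (fun a => decide (a ∉ q.1)) =
        ((List.finRange n).map σ).filter (fun a => decide (a ∉ q.1))
  have hsub : {π : Equiv.Perm (Fin n) | π ≠ σ ∧ dU σ π ≤ t} ⊆ ((T ×ˢ T).biUnion F : Finset _) := by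
    rintro π ⟨-, hπ⟩
    obtain ⟨S, hS, hf⟩ := exists_filter_eq_of_dU_le htn.le hπ
    refine Finset.mem_coe.mpr (Finset.mem_biUnion.mpr
      ⟨(S, S.map π.symm.toEmbedding), ?_, ?_⟩)
    · simp [T, Finset.mem_powersetCard, hS]
    · exact Finset.mem_filter.mpr ⟨Finset.mem_univ π, by simp, hf⟩
  calc _ ≤ ((T ×ˢ T).biUnion F).card := by
        rw [← Set.ncard_coe_finset]
        exact Set.ncard_le_ncard hsub (Finset.finite_toSet _)
    _ ≤ (T ×ˢ T).card * t.factorial := by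
        refine Finset.card_biUnion_le_card_mul _ _ _ fun q hq => ?_
        simp only [T, Finset.mem_product, Finset.mem_powersetCard_univ] at hq
        exact card_filter_map_eq_le hq.1 hq.2 _
    _ = _ := by
        simp only [T, Finset.card_product, Finset.card_powersetCard, Finset.card_univ,
          Fintype.card_fin]
        ring
end

section
/- For any two permutations π, σ ∈ S_n, the minimum number of translocations needed to transform π into σ equals n − LCS(π,σ), where LCS(π,σ) is the length of a longest common subsequence of π and σ viewed as sequences. -/
open scoped Classical

theorem translocate_append_cons {α : Type*} (l₁ l₂ m₁ m₂ : List α) (a : α)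
    (h : l₁ ++ l₂ = m₁ ++ m₂) :
    translocate (l₁ ++ a :: l₂) l₁.length m₁.length = m₁ ++ a :: m₂ := by
  have hins : (m₁ ++ m₂).insertIdx m₁.length a = m₁ ++ a :: m₂ := by
    clear h
    induction m₁ <;> simp_all
  simp [translocate, List.eraseIdx_append_of_length_le, h, hins]

theorem exists_translocate_eq {α : Type*} {l : List α} {i j : ℕ} (hi : i < l.length)
    (hj : j < l.length) : ∃ l₁ a l₂ m₁ m₂, l = l₁ ++ a :: l₂ ∧ l₁ ++ l₂ = m₁ ++ m₂ ∧
      translocate l i j = m₁ ++ a :: m₂ := by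
  have hl : l.take i ++ l[i] :: l.drop (i + 1) = l := by simp
  have hm : l.eraseIdx i = l.take i ++ l.drop (i + 1) := List.eraseIdx_eq_take_drop_succ l i
  refine ⟨l.take i, l[i], l.drop (i + 1), (l.eraseIdx i).take j, (l.eraseIdx i).drop j,
    hl.symm, by rw [List.take_append_drop, hm], ?_⟩
  have := translocate_append_cons (l.take i) (l.drop (i + 1)) ((l.eraseIdx i).take j)
    ((l.eraseIdx i).drop j) l[i] (by rw [List.take_append_drop, hm])
  have hlen : ((l.eraseIdx i).take j).length = j := by
    rw [List.length_take, List.length_eraseIdx_of_lt hi]; omega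
  rwa [hl, hlen, List.length_take_of_le hi.le] at this

theorem List.Sublist.exists_sublist_append {α : Type*} {z l₁ l₂ : List α} {a : α}
    (h : z.Sublist (l₁ ++ a :: l₂)) :
    ∃ z' : List α, z'.Sublist z ∧ z'.Sublist (l₁ ++ l₂) ∧ z.length ≤ z'.length + 1 := by
  obtain ⟨z₁, z₂, rfl, h₁, h₂⟩ := List.sublist_append_iff.1 h
  rcases List.sublist_cons_iff.1 h₂ with h₂ | ⟨r, rfl, h₃⟩
  · exact ⟨z₁ ++ z₂, .refl _, h₁.append h₂, by simp⟩
  · exact ⟨z₁ ++ r, (List.Sublist.refl _).append (List.sublist_cons_self _ _), h₁.append h₃,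
      by simp; omega⟩

theorem List.Sublist.append_of_notMem {α : Type*} {z l₁ l₂ : List α} {a : α}
    (h : z.Sublist (l₁ ++ a :: l₂)) (ha : a ∉ z) : z.Sublist (l₁ ++ l₂) := by
  obtain ⟨z₁, z₂, rfl, h₁, h₂⟩ := List.sublist_append_iff.1 h
  rcases List.sublist_cons_iff.1 h₂ with h₂ | ⟨r, rfl, h₂⟩
  · exact h₁.append h₂
  · simp at ha

theorem bddAbove_common_sublist_lengths {α : Type*} (x y : List α) :
    BddAbove {k | ∃ z : List α, z.Sublist x ∧ z.Sublist y ∧ z.length = k} :=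
  ⟨x.length, by rintro _ ⟨z, hz, -, rfl⟩; exact hz.length_le⟩

theorem List.Sublist.length_le_lcsLen {α : Type*} {x y z : List α} (hx : z.Sublist x)
    (hy : z.Sublist y) : z.length ≤ lcsLen x y :=
  le_csSup (bddAbove_common_sublist_lengths x y) ⟨z, hx, hy, rfl⟩

theorem exists_sublist_length_eq_lcsLen {α : Type*} (x y : List α) :
    ∃ z : List α, z.Sublist x ∧ z.Sublist y ∧ z.length = lcsLen x y :=
  Nat.sSup_mem (s := {k | ∃ z : List α, z.Sublist x ∧ z.Sublist y ∧ z.length = k})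
    ⟨0, [], by simp⟩ (bddAbove_common_sublist_lengths x y)

theorem lcsLen_translocate_le {α : Type*} {l : List α} {i j : ℕ} (hi : i < l.length)
    (hj : j < l.length) (t : List α) : lcsLen (translocate l i j) t ≤ lcsLen l t + 1 := by
  obtain ⟨l₁, a, l₂, m₁, m₂, hl, hlm, ht⟩ := exists_translocate_eq hi hj
  obtain ⟨z, hz, hzt, hlen⟩ := exists_sublist_length_eq_lcsLen (translocate l i j) t
  rw [ht] at hz
  obtain ⟨z', hz', hzm, hle⟩ := hz.exists_sublist_append
  have hzl : z'.Sublist l := by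
    rw [← hlm] at hzm
    rw [hl]
    exact hzm.trans ((List.Sublist.refl _).append (List.sublist_cons_self _ _))
  have := hzl.length_le_lcsLen (hz'.trans hzt)
  omega

theorem lcsLen_path_le {α : Type*} (g : ℕ → List α) (t : List α) (m : ℕ)
    (h : ∀ k < m, ∃ i j, i < (g k).length ∧ j < (g k).length ∧ i ≠ j ∧
      g (k + 1) = translocate (g k) i j) :
    lcsLen (g m) t ≤ lcsLen (g 0) t + m := by
  induction m with
  | zero => rfl
  | succ m ih =>
    obtain ⟨i, j, hi, hj, -, hg⟩ := h m m.lt_succ_self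
    have := lcsLen_translocate_le hi hj t
    have := ih fun k hk => h k (hk.trans m.lt_succ_self)
    rw [hg]
    omega

theorem exists_path_length_le {α : Type*} {t : List α} (ht : t.Nodup) (d : ℕ) {x z : List α}
    (hx : x.Perm t) (hzx : z.Sublist x) (hzt : z.Sublist t) (hd : t.length ≤ z.length + d) :
    ∃ m ≤ d, ∃ g : ℕ → List α, g 0 = x ∧ g m = t ∧
      ∀ k < m, ∃ i j, i < (g k).length ∧ j < (g k).length ∧ i ≠ j ∧
        g (k + 1) = translocate (g k) i j := by
  induction d generalizing x z with
  | zero =>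
    have hxt : x = t :=
      (hzx.eq_of_length_le (by have := hx.length_eq; omega)).symm.trans
        (hzt.eq_of_length_le (by omega))
    exact ⟨0, le_rfl, fun _ => x, rfl, hxt, by simp⟩
  | succ d ih =>
    by_cases hle : t.length ≤ z.length + d
    · obtain ⟨m, hm, h⟩ := ih hx hzx hzt hle
      exact ⟨m, by omega, h⟩
    obtain ⟨a, hat, haz⟩ : ∃ a ∈ t, a ∉ z := by
      by_contra! hsub
      have := (ht.subperm hsub).length_le
      omega
    obtain ⟨t₁, t₂, rfl⟩ := List.append_of_mem hat
    obtain ⟨x₁, x₂, rfl⟩ := List.append_of_mem (hx.mem_iff.2 hat)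
    obtain ⟨z₁, z₂, rfl, hz₁, hz₂⟩ := List.sublist_append_iff.1 (hzt.append_of_notMem haz)
    obtain ⟨y₁, y₂, hxy, hy₁, hy₂⟩ := List.append_sublist_iff.1 (hzx.append_of_notMem haz)
    have hperm : (y₁ ++ a :: y₂).Perm (x₁ ++ a :: x₂) := by
      refine List.perm_middle.trans (.trans ?_ List.perm_middle.symm)
      rw [hxy]
    obtain ⟨m, hm, g, hg0, hgm, hg⟩ := ih (hperm.trans hx) (hy₁.append (hy₂.cons_cons a))
      (hz₁.append (hz₂.cons_cons a)) (by simp at hd ⊢; omega)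
    have hstep := translocate_append_cons x₁ x₂ y₁ y₂ a hxy
    have hlen := congrArg List.length hxy
    simp only [List.length_append] at hlen
    by_cases hij : x₁.length = y₁.length
    · obtain ⟨rfl, rfl⟩ := List.append_inj hxy hij
      exact ⟨m, by omega, g, hg0, hgm, hg⟩
    · refine ⟨m + 1, by omega, fun k => Nat.casesOn k (x₁ ++ a :: x₂) g, rfl, hgm, ?_⟩
      rintro (_ | k) hk
      · refine ⟨x₁.length, y₁.length, by simp, ?_, hij, hg0.trans hstep.symm⟩
        simp
        omega
      · exact hg k (by omega)

/-- For rearrangements of a repetition-free sequence, the Ulam distance is the length minus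
the length of a longest common subsequence. -/
theorem ulamDist_eq_length_sub_lcsLen {α : Type*} {x t : List α} (ht : t.Nodup)
    (hx : x.Perm t) : ulamDist x t = t.length - lcsLen x t := by
  obtain ⟨z, hzx, hzt, hz⟩ := exists_sublist_length_eq_lcsLen x t
  obtain ⟨m, hm, hpath⟩ :=
    exists_path_length_le ht (t.length - lcsLen x t) hx hzx hzt (by omega)
  refine le_antisymm ((Nat.sInf_le hpath).trans hm) (le_csInf ⟨m, hpath⟩ ?_)
  rintro k ⟨g, rfl, rfl, hg⟩
  have h₁ := lcsLen_path_le g (g k) k hg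
  have h₂ := (List.Sublist.refl (g k)).length_le_lcsLen (List.Sublist.refl (g k))
  omega

theorem nodup_seqOf {n : ℕ} (π : Equiv.Perm (Fin n)) : (seqOf π).Nodup :=
  List.nodup_ofFn.2 fun i j h => π.injective (Fin.ext (by simpa using h))

theorem mem_seqOf {n : ℕ} (π : Equiv.Perm (Fin n)) (a : ℕ) :
    a ∈ seqOf π ↔ ∃ i : Fin n, (i : ℕ) + 1 = a := by
  rw [seqOf, List.mem_ofFn', Set.mem_range]
  exact (π.surjective.exists (p := fun i => (i : ℕ) + 1 = a)).symm

theorem seqOf_perm_seqOf {n : ℕ} (π σ : Equiv.Perm (Fin n)) : (seqOf π).Perm (seqOf σ) :=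
  (List.perm_ext_iff_of_nodup (nodup_seqOf π) (nodup_seqOf σ)).2 fun a => by
    rw [mem_seqOf, mem_seqOf]

/-- the minimum number of translocations transforming `π` into `σ`
equals `n − LCS(π,σ)`. -/
theorem stmt6 (n : ℕ) (π σ : Equiv.Perm (Fin n)) :
    dU π σ = n - lcsLen (seqOf π) (seqOf σ) := by
  rw [dU, ulamDist_eq_length_sub_lcsLen (nodup_seqOf σ) (seqOf_perm_seqOf π σ), seqOf, seqOf,
    List.length_ofFn]
end
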